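/- (Wiener lemma with decay, line version) Let \beta > 1. Let f, f_1 : \mathbb{R} \to \mathbb{C} be continuous functions whose Fourier transforms are in L^1(\mathbb{R}) and decay as O(|\xi|^{-\beta}). Suppose f_1 is compactly supported and |f| is bounded away from zero on the support of f_1. Then there exists a continuous g : \mathbb{R} \to \mathbb{C} whose Fourier transform is in L^1 and decays as O(|\xi|^{-\beta}), such that f_1 = f \cdot g pointwise. -/

import Mathlib

open MeasureTheory

/-- `F` is a Fourier representation of `f` by an integrable density decaying like `|ξ| ^ (-β)`. -/
structure IsDecayRep (β : ℝ) (f F : ℝ → ℂ) : Prop where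
  integrable : Integrable F
  decay : ∃ M : ℝ, ∀ ξ : ℝ, |ξ| ^ β * ‖F ξ‖ ≤ M
  eq_integral : ∀ x : ℝ, f x = ∫ ξ : ℝ, Complex.exp (Complex.I * x * ξ) * F ξ

/-- The product of `F` and `G` with respect to additive convolution on the line. -/
noncomputable abbrev conv (F G : ℝ → ℂ) : ℝ → ℂ :=
  convolution F G (ContinuousLinearMap.mul ℂ ℂ) volume

lemma conv_apply (F G : ℝ → ℂ) (ξ : ℝ) : conv F G ξ = ∫ η, F η * G (ξ - η) := rfl

lemma norm_exp_I_mul (x ξ : ℝ) : ‖Complex.exp (Complex.I * x * ξ)‖ = 1 := by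
  rw [show Complex.I * x * ξ = ((x * ξ : ℝ) : ℂ) * Complex.I by push_cast; ring,
    Complex.norm_exp_ofReal_mul_I]

lemma integrable_exp_mul {F : ℝ → ℂ} (hF : Integrable F) (x : ℝ) :
    Integrable fun ξ : ℝ => Complex.exp (Complex.I * x * ξ) * F ξ :=
  hF.bdd_mul (c := 1) (by fun_prop) (.of_forall fun ξ => (norm_exp_I_mul x ξ).le)

lemma integral_exp_mul_conv {F G : ℝ → ℂ} (hF : Integrable F) (hG : Integrable G) (x : ℝ) :
    ∫ ξ : ℝ, Complex.exp (Complex.I * x * ξ) * conv F G ξ =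
      (∫ ξ : ℝ, Complex.exp (Complex.I * x * ξ) * F ξ) *
        ∫ ξ : ℝ, Complex.exp (Complex.I * x * ξ) * G ξ := by
  have h := integral_convolution (μ := volume) (ν := volume) (ContinuousLinearMap.mul ℂ ℂ)
    (integrable_exp_mul hF x) (integrable_exp_mul hG x)
  rw [ContinuousLinearMap.mul_apply'] at h
  rw [← h]
  refine integral_congr_ae (.of_forall fun ξ => ?_)
  simp only [convolution_def, ContinuousLinearMap.mul_apply']
  rw [← integral_const_mul]
  refine integral_congr_ae (.of_forall fun η => ?_)
  dsimp only
  rw [show Complex.I * x * ξ = Complex.I * x * η + Complex.I * x * ((ξ - η : ℝ) : ℂ) by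
    push_cast; ring, Complex.exp_add]
  ring

lemma integrable_conv {F G : ℝ → ℂ} (hF : Integrable F) (hG : Integrable G) :
    Integrable (conv F G) :=
  hF.integrable_convolution _ hG

lemma integral_norm_conv_le {F G : ℝ → ℂ} (hF : Integrable F) (hG : Integrable G) :
    ∫ ξ, ‖conv F G ξ‖ ≤ (∫ ξ, ‖F ξ‖) * ∫ ξ, ‖G ξ‖ := by
  have h := integral_convolution (μ := volume) (ν := volume) (ContinuousLinearMap.mul ℝ ℝ)
    hF.norm hG.norm
  rw [ContinuousLinearMap.mul_apply'] at h
  rw [← h]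
  refine integral_mono (integrable_conv hF hG).norm
    (hF.norm.integrable_convolution _ hG.norm) fun ξ => ?_
  refine (norm_integral_le_integral_norm _).trans_eq ?_
  refine integral_congr_ae (.of_forall fun η => ?_)
  exact norm_mul _ _

lemma conv_decay {β A B : ℝ} (hβ : 0 ≤ β) {F G : ℝ → ℂ} (hF : Integrable F) (hG : Integrable G)
    (hA : ∀ ξ : ℝ, |ξ| ^ β * ‖F ξ‖ ≤ A) (hB : ∀ ξ : ℝ, |ξ| ^ β * ‖G ξ‖ ≤ B) (ξ : ℝ) :
    |ξ| ^ β * ‖conv F G ξ‖ ≤ 2 ^ β * (A * (∫ η, ‖G η‖) + B * ∫ η, ‖F η‖) := by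
  have hA0 : 0 ≤ A := le_trans (by positivity) (hA 0)
  have hB0 : 0 ≤ B := le_trans (by positivity) (hB 0)
  have hG' := (hG.comp_sub_left ξ).norm
  calc |ξ| ^ β * ‖conv F G ξ‖
      ≤ |ξ| ^ β * ∫ η, ‖F η * G (ξ - η)‖ := by
        gcongr
        exact norm_integral_le_integral_norm _
    _ = ∫ η, |ξ| ^ β * ‖F η * G (ξ - η)‖ := by rw [integral_const_mul]
    _ ≤ ∫ η, 2 ^ β * (A * ‖G (ξ - η)‖ + B * ‖F η‖) := by
        refine integral_mono_of_nonneg (.of_forall fun η => by positivity)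
          (((hG'.const_mul A).add (hF.norm.const_mul B)).const_mul _)
          (.of_forall fun η => ?_)
        dsimp only
        rw [norm_mul]
        rcases le_total |ξ - η| |η| with h | h
        · have h1 : |ξ| ^ β ≤ 2 ^ β * |η| ^ β := by
            rw [← Real.mul_rpow (by norm_num) (abs_nonneg _)]
            gcongr
            have := abs_add_le (ξ - η) η
            rw [sub_add_cancel] at this
            linarith
          calc |ξ| ^ β * (‖F η‖ * ‖G (ξ - η)‖)
              ≤ 2 ^ β * |η| ^ β * (‖F η‖ * ‖G (ξ - η)‖) := by gcongr
            _ = 2 ^ β * (|η| ^ β * ‖F η‖ * ‖G (ξ - η)‖) := by ring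
            _ ≤ 2 ^ β * (A * ‖G (ξ - η)‖ + B * ‖F η‖) := by
                gcongr
                exact le_add_of_le_of_nonneg (by gcongr; exact hA η) (by positivity)
        · have h1 : |ξ| ^ β ≤ 2 ^ β * |ξ - η| ^ β := by
            rw [← Real.mul_rpow (by norm_num) (abs_nonneg _)]
            gcongr
            have := abs_add_le (ξ - η) η
            rw [sub_add_cancel] at this
            linarith
          calc |ξ| ^ β * (‖F η‖ * ‖G (ξ - η)‖)
              ≤ 2 ^ β * |ξ - η| ^ β * (‖F η‖ * ‖G (ξ - η)‖) := by gcongr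
            _ = 2 ^ β * (|ξ - η| ^ β * ‖G (ξ - η)‖ * ‖F η‖) := by ring
            _ ≤ 2 ^ β * (A * ‖G (ξ - η)‖ + B * ‖F η‖) := by
                gcongr
                exact le_add_of_nonneg_of_le (by positivity) (by gcongr; exact hB _)
    _ = _ := by
        rw [integral_const_mul, integral_add (hG'.const_mul A) (hF.norm.const_mul B),
          integral_const_mul, integral_const_mul,
          integral_sub_left_eq_self (fun η => ‖G η‖) volume ξ]

namespace IsDecayRep

variable {β : ℝ} {f g F G : ℝ → ℂ}

lemma zero : IsDecayRep β 0 0 := ⟨integrable_zero _ _ _, ⟨0, by simp⟩, by simp⟩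

lemma add (hf : IsDecayRep β f F) (hg : IsDecayRep β g G) : IsDecayRep β (f + g) (F + G) := by
  obtain ⟨A, hA⟩ := hf.decay
  obtain ⟨B, hB⟩ := hg.decay
  refine ⟨hf.integrable.add hg.integrable, ⟨A + B, fun ξ => ?_⟩, fun x => ?_⟩
  · calc |ξ| ^ β * ‖F ξ + G ξ‖ ≤ |ξ| ^ β * (‖F ξ‖ + ‖G ξ‖) := by gcongr; exact norm_add_le _ _
      _ ≤ A + B := by rw [mul_add]; exact add_le_add (hA ξ) (hB ξ)
  · simp only [Pi.add_apply, mul_add]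
    rw [integral_add (integrable_exp_mul hf.integrable x) (integrable_exp_mul hg.integrable x),
      hf.eq_integral, hg.eq_integral]

lemma const_mul (hf : IsDecayRep β f F) (c : ℂ) :
    IsDecayRep β (fun x => c * f x) (fun ξ => c * F ξ) := by
  obtain ⟨A, hA⟩ := hf.decay
  refine ⟨hf.integrable.const_mul c, ⟨‖c‖ * A, fun ξ => ?_⟩, fun x => ?_⟩
  · rw [norm_mul, mul_left_comm]
    gcongr
    exact hA ξ
  · rw [hf.eq_integral, ← integral_const_mul]
    simp only [mul_left_comm]

lemma mul (hβ : 0 ≤ β) (hf : IsDecayRep β f F) (hg : IsDecayRep β g G) :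
    IsDecayRep β (fun x => f x * g x) (conv F G) := by
  obtain ⟨A, hA⟩ := hf.decay
  obtain ⟨B, hB⟩ := hg.decay
  refine ⟨integrable_conv hf.integrable hg.integrable,
    ⟨_, conv_decay hβ hf.integrable hg.integrable hA hB⟩, fun x => ?_⟩
  rw [integral_exp_mul_conv hf.integrable hg.integrable, hf.eq_integral, hg.eq_integral]

lemma norm_le (hf : IsDecayRep β f F) (x : ℝ) : ‖f x‖ ≤ ∫ ξ, ‖F ξ‖ := by
  rw [hf.eq_integral]
  refine (norm_integral_le_integral_norm _).trans_eq ?_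
  simp only [norm_mul, norm_exp_I_mul, one_mul]

lemma continuous (hf : IsDecayRep β f F) : Continuous f := by
  rw [funext hf.eq_integral]
  refine continuous_of_dominated (bound := fun ξ => ‖F ξ‖)
    (fun x => (integrable_exp_mul hf.integrable x).aestronglyMeasurable)
    (fun x => .of_forall fun ξ => ?_) hf.integrable.norm (.of_forall fun ξ => by fun_prop)
  rw [norm_mul, norm_exp_I_mul, one_mul]

lemma comp_affine (hf : IsDecayRep β f F) {a : ℝ} (ha : 0 < a) (b : ℝ) :
    IsDecayRep β (fun x => f (a * x + b))
      (fun ξ => (a⁻¹ : ℂ) * (Complex.exp (Complex.I * b * (ξ / a : ℝ)) * F (ξ / a))) := by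
  obtain ⟨A, hA⟩ := hf.decay
  refine ⟨((integrable_exp_mul hf.integrable b).comp_div ha.ne').const_mul _,
    ⟨a⁻¹ * (a ^ β * A), fun ξ => ?_⟩, fun x => ?_⟩
  · have h : |ξ| ^ β = a ^ β * |ξ / a| ^ β := by
      rw [← Real.mul_rpow ha.le (abs_nonneg _), abs_div, abs_of_pos ha, mul_div_cancel₀ _ ha.ne']
    rw [norm_mul, norm_mul, norm_exp_I_mul, one_mul, norm_inv, Complex.norm_real,
      Real.norm_of_nonneg ha.le, mul_left_comm, h, mul_assoc]
    gcongr
    exact hA _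
  · rw [hf.eq_integral]
    have h := Measure.integral_comp_div
      (fun ξ : ℝ => (a⁻¹ : ℂ) * (Complex.exp (Complex.I * (a * x + b : ℝ) * ξ) * F ξ)) a
    have ha' : (a : ℂ) ≠ 0 := by exact_mod_cast ha.ne'
    rw [abs_of_pos ha, Complex.real_smul, integral_const_mul _ fun ξ : ℝ => Complex.exp _ * F ξ,
      mul_inv_cancel_left₀ ha'] at h
    rw [← h]
    refine integral_congr_ae (.of_forall fun ξ => ?_)
    dsimp only
    rw [mul_left_comm (Complex.exp _), ← mul_assoc (Complex.exp _), ← Complex.exp_add]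
    congr 4
    push_cast
    field_simp

lemma tsum {f F : ℕ → ℝ → ℂ} (hf : ∀ n, IsDecayRep β (f n) (F n))
    (hF : Summable fun n => ∫ ξ, ‖F n ξ‖) {d : ℕ → ℝ} (hd : Summable d)
    (hFd : ∀ n ξ, |ξ| ^ β * ‖F n ξ‖ ≤ d n) :
    IsDecayRep β (fun x => ∑' n, f n x) (fun ξ => ∑' n, F n ξ) := by
  have hint (n : ℕ) := (hf n).integrable
  have hne : ∑' n, eLpNorm (F n) 1 volume ≠ ⊤ := by
    have (n : ℕ) : eLpNorm (F n) 1 volume = ENNReal.ofReal (∫ ξ, ‖F n ξ‖) := by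
      rw [eLpNorm_one_eq_lintegral_enorm, ofReal_integral_norm_eq_lintegral_enorm (hint n)]
    simp only [this]
    exact hF.tsum_ofReal_ne_top
  have hsum := summable_norm_of_tsum_eLpNorm_ne_top le_rfl
    (fun n => (hint n).aestronglyMeasurable) hne
  refine ⟨⟨?_, ?_⟩, ⟨∑' n, d n, fun ξ => ?_⟩, fun x => ?_⟩
  · refine aestronglyMeasurable_of_tendsto_ae Filter.atTop
      (f := fun N ξ => ∑ n ∈ Finset.range N, F n ξ)
      (fun N => Finset.aestronglyMeasurable_fun_sum _ fun n _ => (hint n).aestronglyMeasurable) ?_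
    filter_upwards [hsum] with ξ hξ using hξ.of_norm.hasSum.tendsto_sum_nat
  · refine lt_of_le_of_lt (lintegral_mono fun ξ => enorm_tsum_le_tsum_enorm) ?_
    rw [lintegral_tsum fun n => (hint n).aestronglyMeasurable.enorm]
    simpa only [eLpNorm_one_eq_lintegral_enorm] using hne.lt_top
  · have h : |ξ| ^ β * ‖∑' n, F n ξ‖ = ‖∑' n, ((|ξ| ^ β : ℝ) : ℂ) * F n ξ‖ := by
      rw [tsum_mul_left, norm_mul, Complex.norm_real, Real.norm_of_nonneg (by positivity)]
    rw [h]
    refine tsum_of_norm_bounded hd.hasSum fun n => ?_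
    rw [norm_mul, Complex.norm_real, Real.norm_of_nonneg (by positivity)]
    exact hFd n ξ
  · simp only [(hf _).eq_integral, ← tsum_mul_left]
    refine integral_tsum_of_summable_integral_norm (fun n => integrable_exp_mul (hint n) x) ?_
    simpa only [norm_mul, norm_exp_I_mul, one_mul] using hF

/-- If the density of `h` has small `L¹` norm, then `1 - h` is invertible modulo constants. -/
lemma exists_neumann_inverse {h H : ℝ → ℂ} (hβ : 0 ≤ β) (hh : IsDecayRep β h H)
    (hsmall : 2 ^ β * ∫ ξ, ‖H ξ‖ ≤ 1 / 2) :
    ∃ w W : ℝ → ℂ, IsDecayRep β w W ∧ ∀ x, (1 - h x) * (1 + w x) = 1 := by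
  obtain ⟨D, hD⟩ := hh.decay
  set r := ∫ ξ, ‖H ξ‖ with hr
  have hr0 : 0 ≤ r := integral_nonneg fun _ => norm_nonneg _
  have hD0 : 0 ≤ D := le_trans (by positivity) (hD 0)
  have hC : (1 : ℝ) ≤ 2 ^ β := Real.one_le_rpow (by norm_num) hβ
  set C : ℝ := 2 ^ β
  set s := C * r with hs
  have hs0 : 0 ≤ s := by positivity
  have hrs : r ≤ s := le_mul_of_one_le_left hr0 hC
  let P : ℕ → ℝ → ℂ := fun n => Nat.rec H (fun _ G => conv H G) n
  have hP (n : ℕ) : IsDecayRep β (fun x => h x ^ (n + 1)) (P n) := by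
    induction n with
    | zero => simp only [zero_add, pow_one]; exact hh
    | succ n ih =>
      have := hh.mul hβ ih
      simp only [← pow_succ'] at this
      exact this
  have hPr (n : ℕ) : ∫ ξ, ‖P n ξ‖ ≤ s ^ (n + 1) := by
    induction n with
    | zero => rw [zero_add, pow_one]; exact hrs
    | succ n ih =>
      refine (integral_norm_conv_le hh.integrable (hP n).integrable).trans ?_
      rw [pow_succ' s (n + 1)]
      gcongr
  have hPd (n : ℕ) : ∀ ξ : ℝ, |ξ| ^ β * ‖P n ξ‖ ≤ C * D * ((n + 1 : ℕ) * s ^ n) := by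
    induction n with
    | zero =>
      intro ξ
      refine (hD ξ).trans ?_
      simpa using le_mul_of_one_le_left hD0 hC
    | succ n ih =>
      intro ξ
      refine (conv_decay hβ hh.integrable (hP n).integrable hD ih ξ).trans ?_
      rw [← hr]
      calc C * (D * (∫ η, ‖P n η‖) + C * D * ((n + 1 : ℕ) * s ^ n) * r)
          ≤ C * (D * s ^ (n + 1) + C * D * ((n + 1 : ℕ) * s ^ n) * r) := by
            gcongr
            exact hPr n
        _ = C * D * ((n + 1 + 1 : ℕ) * s ^ (n + 1)) := by
            rw [hs]
            push_cast
            ring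
  have hs1 : s < 1 := hsmall.trans_lt (by norm_num)
  have hgeom : Summable fun n : ℕ => s ^ (n + 1) :=
    (summable_nat_add_iff 1).2 (summable_geometric_of_lt_one hs0 hs1)
  have hgeom' : Summable fun n : ℕ => C * D * ((n + 1 : ℕ) * s ^ n) := by
    refine Summable.mul_left _ ?_
    have h1 := summable_pow_mul_geometric_of_norm_lt_one (R := ℝ) 1
      (by rwa [Real.norm_of_nonneg hs0] : ‖s‖ < 1)
    have h2 := h1.add (summable_geometric_of_lt_one hs0 hs1)
    refine h2.congr fun n => ?_
    push_cast
    ring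
  refine ⟨_, _, tsum hP (hgeom.of_nonneg_of_le
    (fun n => integral_nonneg fun _ => norm_nonneg _) hPr) hgeom' hPd, fun x => ?_⟩
  have hx : ‖h x‖ < 1 := ((hh.norm_le x).trans hrs).trans_lt hs1
  have h1 : 1 + ∑' n, h x ^ (n + 1) = ∑' n, h x ^ n := by
    rw [(summable_geometric_of_norm_lt_one hx).tsum_eq_zero_add, pow_zero]
  rw [h1]
  exact mul_neg_geom_series _ hx

end IsDecayRep

open scoped FourierTransform in
lemma exists_schwartz_isDecayRep {β : ℝ} (hβ : 0 ≤ β) :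
    ∃ (φ : ℝ → ℂ) (Φ : SchwartzMap ℝ ℂ), IsDecayRep β φ Φ ∧ ∀ x, |x| ≤ 1 → φ x = 1 := by
  let b : ContDiffBump (0 : ℝ) := ⟨1, 2, one_pos, one_lt_two⟩
  have hb1 : HasCompactSupport fun x => (b x : ℂ) :=
    b.hasCompactSupport.comp_left (g := ((↑) : ℝ → ℂ)) Complex.ofReal_zero
  have hb2 : ContDiff ℝ ((⊤ : ℕ∞) : WithTop ℕ∞) fun x => (b x : ℂ) :=
    Complex.ofRealCLM.contDiff.comp b.contDiff
  let ψ : SchwartzMap ℝ ℂ := hb1.toSchwartzMap hb2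
  have hψ (x : ℝ) : ψ x = b x := rfl
  refine ⟨fun x => ψ (x / (2 * Real.pi)), 𝓕 ψ, ⟨(𝓕 ψ).integrable, ?_, fun x => ?_⟩, fun x hx => ?_⟩
  · obtain ⟨k, hk⟩ := exists_nat_ge β
    refine ⟨_, fun ξ => le_trans ?_ ((SchwartzMap.one_add_le_sup_seminorm_apply (𝕜 := ℝ)
      (m := (k, 0)) le_rfl le_rfl (𝓕 ψ) ξ))⟩
    rw [norm_iteratedFDeriv_zero]
    gcongr
    rw [Real.norm_eq_abs]
    rw [← Real.rpow_natCast]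
    exact (Real.rpow_le_rpow (abs_nonneg ξ) (by linarith) hβ).trans
      (Real.rpow_le_rpow_of_exponent_le (by linarith [abs_nonneg ξ]) hk)
  · conv_lhs => rw [← FourierTransform.fourierInv_fourier_eq (E := SchwartzMap ℝ ℂ)
      (F := SchwartzMap ℝ ℂ) ψ]
    rw [SchwartzMap.fourierInv_coe, Real.fourierInv_eq']
    refine integral_congr_ae (.of_forall fun ξ => ?_)
    have : (Real.pi : ℂ) ≠ 0 := by exact_mod_cast Real.pi_ne_zero
    simp only [smul_eq_mul, Inner.inner]
    congr 2
    simp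
    field_simp
  · dsimp only
    rw [hψ, b.one_of_mem_closedBall, Complex.ofReal_one]
    rw [mem_closedBall_zero_iff, Real.norm_eq_abs, abs_div, abs_of_pos Real.two_pi_pos]
    exact (div_le_one Real.two_pi_pos).2 (hx.trans (by linarith [Real.pi_gt_three]))

lemma SchwartzMap.continuous_integral_norm_sub_translate (Φ : SchwartzMap ℝ ℂ) :
    Continuous fun a : ℝ => ∫ ξ, ‖Φ (ξ - a) - Φ ξ‖ := by
  have hC (ξ : ℝ) := SchwartzMap.one_add_le_sup_seminorm_apply (𝕜 := ℝ)
      (m := (2, 0)) le_rfl le_rfl Φ ξ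
  set C := 2 ^ ((2, 0) : ℕ × ℕ).1 *
    ((Finset.Iic ((2, 0) : ℕ × ℕ)).sup fun m => SchwartzMap.seminorm ℝ m.1 m.2) Φ
  simp only [norm_iteratedFDeriv_zero, Real.norm_eq_abs] at hC
  refine continuous_iff_continuousAt.2 fun a₀ => ?_
  have hint : Integrable fun ξ : ℝ =>
      C * (2 + |a₀|) ^ 2 * (1 + ‖ξ‖) ^ (-2 : ℝ) + ‖Φ ξ‖ :=
    ((integrable_one_add_norm (by simp)).const_mul _).add Φ.integrable.norm
  refine continuousAt_of_dominated (.of_forall fun a => ?_) ?_ hint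
    (.of_forall fun ξ => ?_)
  · exact (by fun_prop : Continuous fun ξ => ‖Φ (ξ - a) - Φ ξ‖).aestronglyMeasurable
  · filter_upwards [Metric.closedBall_mem_nhds a₀ one_pos] with a ha
    refine .of_forall fun ξ => ?_
    rw [norm_norm]
    refine (norm_sub_le _ _).trans (add_le_add_left ?_ _)
    rw [Metric.mem_closedBall, Real.dist_eq] at ha
    have h1 : |a| ≤ 1 + |a₀| := by
      have := abs_add_le (a - a₀) a₀
      rw [sub_add_cancel] at this
      linarith
    have h2 : 1 + |ξ| ≤ (1 + |ξ - a|) * (2 + |a₀|) := by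
      have := abs_add_le (ξ - a) a
      rw [sub_add_cancel] at this
      nlinarith [abs_nonneg (ξ - a), abs_nonneg a₀]
    rw [Real.rpow_neg (by positivity), ← div_eq_mul_inv, Real.norm_eq_abs,
      le_div_iff₀ (by positivity)]
    calc ‖Φ (ξ - a)‖ * (1 + |ξ|) ^ (2 : ℝ)
        ≤ ‖Φ (ξ - a)‖ * ((1 + |ξ - a|) * (2 + |a₀|)) ^ 2 := by
          rw [Real.rpow_two]
          gcongr
      _ = (1 + |ξ - a|) ^ 2 * ‖Φ (ξ - a)‖ * (2 + |a₀|) ^ 2 := by ring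
      _ ≤ C * (2 + |a₀|) ^ 2 := by
          gcongr
          exact hC _
  · exact (by fun_prop : Continuous fun a => ‖Φ (ξ - a) - Φ ξ‖).continuousAt

lemma integral_norm_conv_sub_le {F : ℝ → ℂ} (hF : Integrable F) (Φ : SchwartzMap ℝ ℂ) :
    ∫ ξ, ‖conv F Φ ξ - (∫ η, F η) * Φ ξ‖ ≤ ∫ η, ‖F η‖ * ∫ ξ, ‖Φ (ξ - η) - Φ ξ‖ := by
  have hprod : Integrable (Function.uncurry fun ξ η => ‖F η‖ * ‖Φ (ξ - η) - Φ ξ‖)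
      ((volume : Measure ℝ).prod volume) := by
    have h1 := hF.convolution_integrand (ContinuousLinearMap.mul ℂ ℂ) (μ := volume) Φ.integrable
    have h2 := (Φ.integrable (μ := volume)).mul_prod hF
    refine (h1.sub h2).norm.congr (.of_forall fun p => ?_)
    simp only [Pi.sub_apply, ContinuousLinearMap.mul_apply', Function.uncurry, ← norm_mul]
    ring_nf
  calc ∫ ξ, ‖conv F Φ ξ - (∫ η, F η) * Φ ξ‖
      ≤ ∫ ξ, ∫ η, ‖F η‖ * ‖Φ (ξ - η) - Φ ξ‖ := by
        refine integral_mono_of_nonneg (.of_forall fun _ => norm_nonneg _)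
          hprod.integral_prod_left (.of_forall fun ξ => ?_)
        dsimp only
        have h1 : Integrable fun η => F η * Φ (ξ - η) := by
          refine hF.mul_bdd (c := SchwartzMap.seminorm ℝ 0 0 Φ)
            (by fun_prop) (.of_forall fun η => Φ.norm_le_seminorm ℝ _)
        rw [conv_apply, ← integral_mul_const, ← integral_sub h1 (hF.mul_const _)]
        refine (norm_integral_le_integral_norm _).trans_eq ?_
        simp only [← mul_sub, norm_mul]
    _ = ∫ η, ∫ ξ, ‖F η‖ * ‖Φ (ξ - η) - Φ ξ‖ := integral_integral_swap hprod
    _ = _ := by simp only [integral_const_mul]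

lemma tendsto_integral_norm_mul_translate {F : ℝ → ℂ} (hF : Integrable F) (Φ : SchwartzMap ℝ ℂ) :
    Filter.Tendsto (fun ε : ℝ => ∫ η, ‖F η‖ * ∫ ξ, ‖Φ (ξ - ε * η) - Φ ξ‖) (nhds 0) (nhds 0) := by
  have hω := Φ.continuous_integral_norm_sub_translate
  have h := tendsto_integral_filter_of_dominated_convergence (l := nhds (0 : ℝ)) (μ := volume)
    (F := fun ε η => ‖F η‖ * ∫ ξ, ‖Φ (ξ - ε * η) - Φ ξ‖) (f := fun _ => 0)
    (fun η => ‖F η‖ * (2 * ∫ ξ, ‖Φ ξ‖)) (.of_forall fun ε => ?_)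
    (.of_forall fun ε => .of_forall fun η => ?_) (hF.norm.mul_const _) (.of_forall fun η => ?_)
  · simpa using h
  · exact hF.norm.aestronglyMeasurable.mul
      (hω.comp (continuous_const_mul ε)).aestronglyMeasurable
  · have hΦ := (Φ.integrable (μ := volume)).norm
    have hΦ' := hΦ.comp_sub_right (ε * η)
    rw [norm_mul, norm_norm, Real.norm_of_nonneg (integral_nonneg fun _ => norm_nonneg _)]
    gcongr
    calc ∫ ξ, ‖Φ (ξ - ε * η) - Φ ξ‖ ≤ ∫ ξ, (‖Φ (ξ - ε * η)‖ + ‖Φ ξ‖) :=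
          integral_mono_of_nonneg (.of_forall fun _ => norm_nonneg _) (hΦ'.add hΦ)
            (.of_forall fun ξ => norm_sub_le _ _)
      _ = 2 * ∫ ξ, ‖Φ ξ‖ := by
          rw [integral_add hΦ' hΦ, integral_sub_right_eq_self (fun ξ => ‖Φ ξ‖), two_mul]
  · have := ((hω.comp (continuous_mul_const η)).tendsto 0).const_mul ‖F η‖
    simpa using this

/-- Local inversion at a point where the function does not vanish. -/
lemma IsDecayRep.exists_local_inverse {β : ℝ} {f F : ℝ → ℂ} (hβ : 0 ≤ β)
    (hf : IsDecayRep β f F) {x₀ : ℝ} (hx₀ : f x₀ ≠ 0) :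
    ∃ ε > 0, ∃ g G : ℝ → ℂ, IsDecayRep β g G ∧
      ∀ x ∈ Metric.closedBall x₀ ε, f x * g x = 1 := by
  obtain ⟨φ, Φ, hφ, hφ1⟩ := exists_schwartz_isDecayRep hβ
  have hc : 0 < ‖f x₀‖ := norm_pos_iff.2 hx₀
  set c := f x₀
  have hlim := (tendsto_integral_norm_mul_translate hf.integrable Φ).mono_left
    (nhdsWithin_le_nhds (s := Set.Ioi 0))
  obtain ⟨ε, hε, hε0⟩ := ((hlim.eventually_le_const
    (by positivity : 0 < ‖c‖ / (2 * 2 ^ β))).and self_mem_nhdsWithin).exists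
  have hfε := hf.comp_affine hε0 x₀
  set Fε : ℝ → ℂ := fun ξ =>
    (ε⁻¹ : ℂ) * (Complex.exp (Complex.I * x₀ * (ξ / ε : ℝ)) * F (ξ / ε)) with hFε
  have hnorm (η : ℝ) : ‖Fε η‖ = ε⁻¹ * ‖F (η / ε)‖ := by
    rw [hFε]
    simp only [norm_mul, norm_exp_I_mul, one_mul, norm_inv, Complex.norm_real,
      Real.norm_of_nonneg hε0.le]
  have hint : ∫ η, Fε η = c := by
    have := hfε.eq_integral 0
    simp only [mul_zero, zero_add, Complex.ofReal_zero, zero_mul, Complex.exp_zero, one_mul] at this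
    exact this.symm
  have hsmall : ∫ ξ, ‖conv Fε Φ ξ - c * Φ ξ‖ ≤ ‖c‖ / (2 * 2 ^ β) := by
    refine le_trans ?_ hε
    have h := integral_norm_conv_sub_le hfε.integrable Φ
    rw [hint] at h
    refine h.trans_eq ?_
    have h' := Measure.integral_comp_div
      (fun η => ε⁻¹ * (‖F η‖ * ∫ ξ, ‖Φ (ξ - ε * η) - Φ ξ‖)) ε
    rw [abs_of_pos hε0, smul_eq_mul, integral_const_mul ε⁻¹ fun η => ‖F η‖ * _,
      mul_inv_cancel_left₀ hε0.ne'] at h'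
    rw [← h']
    simp only [hnorm, mul_div_cancel₀ _ hε0.ne', mul_assoc]
  have hh := ((hfε.mul hβ hφ).add (hφ.const_mul (-c))).const_mul (-c⁻¹)
  obtain ⟨w, W, hw, hw1⟩ := hh.exists_neumann_inverse hβ (by
    have : ∀ ξ, ‖-c⁻¹ * (conv Fε Φ + fun ξ => -c * Φ ξ) ξ‖ =
        ‖c‖⁻¹ * ‖conv Fε Φ ξ - c * Φ ξ‖ := fun ξ => by
      rw [norm_mul, norm_neg, norm_inv, Pi.add_apply, neg_mul, sub_eq_add_neg]
    simp only [this, integral_const_mul]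
    calc (2 : ℝ) ^ β * (‖c‖⁻¹ * ∫ ξ, ‖conv Fε Φ ξ - c * Φ ξ‖)
        ≤ 2 ^ β * (‖c‖⁻¹ * (‖c‖ / (2 * 2 ^ β))) := by gcongr
      _ = 1 / 2 := by field_simp)
  have hg := ((hφ.add (hφ.mul hβ hw)).const_mul c⁻¹).comp_affine (inv_pos.2 hε0) (-(ε⁻¹ * x₀))
  refine ⟨ε, hε0, _, _, hg, fun x hx => ?_⟩
  have hy : ε * (ε⁻¹ * x + -(ε⁻¹ * x₀)) + x₀ = x := by field_simp; ring
  have hy1 : |ε⁻¹ * x + -(ε⁻¹ * x₀)| ≤ 1 := by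
    rw [← mul_neg, ← mul_add, abs_mul, abs_of_pos (inv_pos.2 hε0), ← sub_eq_add_neg,
      inv_mul_le_one₀ hε0]
    exact hx
  have h1 := hw1 (ε⁻¹ * x + -(ε⁻¹ * x₀))
  simp only [Pi.add_apply, hy, hφ1 _ hy1] at h1 ⊢
  linear_combination h1 + (1 + w (ε⁻¹ * x + -(ε⁻¹ * x₀))) * inv_mul_cancel₀ hx₀

/-- A function which does not vanish on a compact set is invertible on that set. -/
lemma IsDecayRep.exists_inverse_on_compact {β : ℝ} {f F : ℝ → ℂ} (hβ : 0 ≤ β)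
    (hf : IsDecayRep β f F) {K : Set ℝ} (hK : IsCompact K) (hfK : ∀ x ∈ K, f x ≠ 0) :
    ∃ g G : ℝ → ℂ, IsDecayRep β g G ∧ ∀ x ∈ K, f x * g x = 1 := by
  refine hK.induction_on (p := fun S => ∃ g G : ℝ → ℂ, IsDecayRep β g G ∧ ∀ x ∈ S, f x * g x = 1)
    ⟨0, 0, .zero, by simp⟩ ?_ ?_ fun x hx => ?_
  · rintro s t hst ⟨g, G, hg, h⟩
    exact ⟨g, G, hg, fun x hx => h x (hst hx)⟩
  · rintro s t ⟨g₁, G₁, hg₁, h₁⟩ ⟨g₂, G₂, hg₂, h₂⟩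
    refine ⟨_, _, (hg₁.add hg₂).add ((hf.mul hβ (hg₁.mul hβ hg₂)).const_mul (-1)), ?_⟩
    rintro x (hx | hx)
    · have := h₁ x hx
      simp only [Pi.add_apply]
      linear_combination (1 - f x * g₂ x) * this
    · have := h₂ x hx
      simp only [Pi.add_apply]
      linear_combination (1 - f x * g₁ x) * this
  · obtain ⟨ε, hε, g, G, hg, h⟩ := hf.exists_local_inverse hβ (hfK x hx)
    exact ⟨_, mem_nhdsWithin_of_mem_nhds (Metric.closedBall_mem_nhds x hε), g, G, hg, h⟩

/-- Wiener lemma with decay (line version): if `f, f₁ ∈ 𝓡_β` (i.e. they are inverse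
Fourier transforms of integrable functions decaying like `O(|ξ|^{-β})`), `f₁` has
compact support, and `|f|` is bounded below on `supp f₁`, then `f₁ = f g` with
`g ∈ 𝓡_β`. -/
theorem stmt_14 (β : ℝ) (hβ : 1 < β)
    (f f₁ : ℝ → ℂ) (F F₁ : ℝ → ℂ)
    (hf : Continuous f) (hf₁ : Continuous f₁)
    (hFint : Integrable F) (hF₁int : Integrable F₁)
    (hFdec : ∃ M : ℝ, ∀ ξ : ℝ, |ξ| ^ β * ‖F ξ‖ ≤ M)
    (hF₁dec : ∃ M : ℝ, ∀ ξ : ℝ, |ξ| ^ β * ‖F₁ ξ‖ ≤ M)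
    (hfF : ∀ x : ℝ, f x = ∫ ξ : ℝ, Complex.exp (Complex.I * x * ξ) * F ξ)
    (hf₁F : ∀ x : ℝ, f₁ x = ∫ ξ : ℝ, Complex.exp (Complex.I * x * ξ) * F₁ ξ)
    (hcs : HasCompactSupport f₁)
    (hlow : ∃ δ > (0 : ℝ), ∀ x ∈ tsupport f₁, δ ≤ ‖f x‖) :
    ∃ g G : ℝ → ℂ, Continuous g ∧ Integrable G ∧
      (∃ M : ℝ, ∀ ξ : ℝ, |ξ| ^ β * ‖G ξ‖ ≤ M) ∧
      (∀ x : ℝ, g x = ∫ ξ : ℝ, Complex.exp (Complex.I * x * ξ) * G ξ) ∧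
      (∀ x : ℝ, f₁ x = f x * g x) := by
  have hβ0 : 0 ≤ β := by linarith
  have hf' : IsDecayRep β f F := ⟨hFint, hFdec, hfF⟩
  have hf₁' : IsDecayRep β f₁ F₁ := ⟨hF₁int, hF₁dec, hf₁F⟩
  obtain ⟨δ, hδ, hlow⟩ := hlow
  obtain ⟨g, G, hg, hfg⟩ := hf'.exists_inverse_on_compact hβ0 hcs.isCompact fun x hx =>
    norm_pos_iff.1 (hδ.trans_le (hlow x hx))
  have hr := hf₁'.mul hβ0 hg
  refine ⟨_, _, hr.continuous, hr.integrable, hr.decay, hr.eq_integral, fun x => ?_⟩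
  by_cases hx : x ∈ tsupport f₁
  · linear_combination -f₁ x * hfg x hx
  · rw [image_eq_zero_of_notMem_tsupport hx, zero_mul, mul_zero]
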